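/- For every positive integer n there exists a function R from the set of all functions f : {1,…,n} → {1,…,n} to the set of trees on n vertices such that (i) every tree on n vertices has exactly n² preimages under R, and (ii) for every f, the symmetric difference of the undirected edge multiset E(f) of the functional graph of f and the edge set of the tree R(f) has size at most 2·c(f), where c(f) is the number of cycles of f. -/

import Mathlib

open scoped Classical

/-- The core of a self-map: the set of points lying on a cycle,
i.e. `x` with `f^[j] x = x` for some `j ≥ 1`. -/
def inCore {V : Type*} (f : V → V) (x : V) : Prop := ∃ j ≥ 1, f^[j] x = x

/-- The number of cycles of a self-map: the number of distinct forward orbits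
of points of the core (each cycle is the forward orbit of any of its points). -/
noncomputable def cycleCount {V : Type*} (f : V → V) : ℕ :=
  Set.ncard ((fun x => {y | ∃ j : ℕ, f^[j] x = y}) '' {x | inCore f x})

/-- The undirected edge multiset of the functional graph of `f` : the multiset of
unordered pairs `{x, f x}`, with multiplicity, loops allowed. -/
def funEdges {n : ℕ} (f : Fin n → Fin n) : Multiset (Sym2 (Fin n)) :=
  Finset.univ.val.map (fun x => s(x, f x))

/-- The edge multiset of a simple graph on `Fin n` (each edge counted once). -/
noncomputable def graphEdges {n : ℕ} (G : SimpleGraph (Fin n)) : Multiset (Sym2 (Fin n)) :=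
  (G.edgeSet.toFinite.toFinset).val

/-- Size of the multiset symmetric difference `(A - B) + (B - A)`. -/
noncomputable def msdCard {α : Type*} (A B : Multiset α) : ℕ :=
  Multiset.card ((A - B) + (B - A))

/-- `g` is the parent function of a tree rooted at `r`. -/
def IsRootedAt {V : Type*} (g : V → V) (r : V) : Prop := g r = r ∧ ∀ x, ∃ k, g^[k] x = r

/-- The simple graph underlying the functional graph of `g`. -/
def functionalGraph {V : Type*} (g : V → V) : SimpleGraph V :=
  SimpleGraph.fromRel fun x y => g x = y

section Rooted

variable {V : Type*} {g : V → V} {r : V}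

theorem IsRootedAt.eq_root_of_fixed (h : IsRootedAt g r) {x : V} (hx : g x = x) : x = r := by
  obtain ⟨k, hk⟩ := h.2 x
  rw [Function.iterate_fixed hx] at hk
  exact hk

theorem functionalGraph_adj {x y : V} :
    (functionalGraph g).Adj x y ↔ x ≠ y ∧ (g x = y ∨ g y = x) := by
  simp [functionalGraph]

theorem IsRootedAt.connected (h : IsRootedAt g r) : (functionalGraph g).Connected := by
  have key : ∀ k x, g^[k] x = r → (functionalGraph g).Reachable x r := by
    intro k
    induction k with
    | zero => rintro x rfl; exact SimpleGraph.Reachable.refl _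
    | succ k ih =>
      intro x hx
      have hr := ih (g x) hx
      by_cases hgx : g x = x
      · rwa [hgx] at hr
      · exact (functionalGraph_adj.2 ⟨Ne.symm hgx, .inl rfl⟩ :
          (functionalGraph g).Adj x (g x)).reachable.trans hr
  have key' : ∀ x, (functionalGraph g).Reachable x r := fun x =>
    (h.2 x).elim fun k hk => key k x hk
  have : Nonempty V := ⟨r⟩
  exact ⟨fun x y => (key' x).trans (key' y).symm⟩

theorem IsRootedAt.edgeSet_eq (h : IsRootedAt g r) :
    (functionalGraph g).edgeSet = (fun x => s(x, g x)) '' {x | x ≠ r} := by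
  ext e
  induction e with
  | h x y =>
    simp only [SimpleGraph.mem_edgeSet, functionalGraph_adj, Set.mem_image, Set.mem_ofPred_eq]
    constructor
    · rintro ⟨hne, rfl | rfl⟩
      · exact ⟨x, fun hx => hne (by rw [hx, h.1]), rfl⟩
      · exact ⟨y, fun hy => hne (by rw [hy, h.1]), Sym2.eq_swap⟩
    · rintro ⟨z, hz, he⟩
      have hzz : g z ≠ z := fun hzz => hz (h.eq_root_of_fixed hzz)
      rw [Sym2.eq_iff] at he
      grind

theorem IsRootedAt.isTree [Finite V] (h : IsRootedAt g r) : (functionalGraph g).IsTree := by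
  have := Fintype.ofFinite V
  refine SimpleGraph.isTree_iff_connected_and_card.2 ⟨h.connected, ?_⟩
  refine le_antisymm ?_ h.connected.card_vert_le_card_edgeSet_add_one
  have h1 : Nat.card (functionalGraph g).edgeSet ≤ (Finset.univ.erase r).card := by
    rw [Nat.card_coe_set_eq, h.edgeSet_eq, ← Set.ncard_coe_finset]
    convert Set.ncard_image_le (Set.toFinite {x | x ≠ r}) using 2
    ext x
    simp
  rw [Finset.card_erase_of_mem (Finset.mem_univ _), Finset.card_univ] at h1
  have h2 : 0 < Fintype.card V := Fintype.card_pos_iff.2 ⟨r⟩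
  rw [Nat.card_eq_fintype_card (α := V)]
  omega

theorem IsRootedAt.eq_of_functionalGraph_eq {g' : V → V} (h : IsRootedAt g r)
    (h' : IsRootedAt g' r) (he : functionalGraph g = functionalGraph g') : g = g' := by
  have key : ∀ k x, g' x ≠ r → g (g' x) = x → g'^[k] (g' x) ≠ r := by
    intro k
    induction k with
    | zero => exact fun x hx _ => hx
    | succ k ih =>
      intro x hx hgx
      set y := g' x with hy
      have hyy : g' y ≠ y := fun hyy => hx (h'.eq_root_of_fixed hyy)
      have hadj : (functionalGraph g).Adj y (g' y) := by
        rw [he]; exact functionalGraph_adj.2 ⟨hyy.symm, .inl rfl⟩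
      rcases (functionalGraph_adj.1 hadj).2 with hg | hg
      · have hp : ∀ i, g'^[i] x = x ∨ g'^[i] x = y := by
          intro i
          induction i with
          | zero => exact .inl rfl
          | succ i ihi =>
            rw [Function.iterate_succ_apply']
            rcases ihi with hi | hi <;> rw [hi]
            · exact .inr rfl
            · exact .inl (hg.symm.trans hgx)
        obtain ⟨i, hi⟩ := h'.2 x
        rcases hp i with hq | hq
        · rw [hi] at hq
          exact absurd (by rw [hy, ← hq, h'.1]) hx
        · exact absurd (hq.symm.trans hi) hx
      · rw [Function.iterate_succ_apply]
        refine ih y (fun hr => ?_) hg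
        rw [hr, h.1] at hg
        exact hx hg.symm
  funext x
  by_contra hne
  have hxr : x ≠ r := by rintro rfl; exact hne (h.1.trans h'.1.symm)
  have hxx : g' x ≠ x := fun hxx => hxr (h'.eq_root_of_fixed hxx)
  have hadj : (functionalGraph g).Adj x (g' x) := by
    rw [he]; exact functionalGraph_adj.2 ⟨hxx.symm, .inl rfl⟩
  have hg : g (g' x) = x := (functionalGraph_adj.1 hadj).2.resolve_left hne
  obtain ⟨k, hk⟩ := h'.2 (g' x)
  refine key k x (fun hr => ?_) hg hk
  rw [hr, h.1] at hg
  exact hxr hg.symm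

theorem SimpleGraph.IsTree.exists_isRootedAt {G : SimpleGraph V} (hG : G.IsTree) (r : V) :
    ∃ g : V → V, IsRootedAt g r ∧ functionalGraph g = G := by
  have hstep : ∀ x, ∃ y, (x = r → y = r) ∧ (x ≠ r → G.Adj x y ∧ G.dist x r = G.dist y r + 1) := by
    intro x
    by_cases hx : x = r
    · exact ⟨r, fun _ => rfl, fun h => absurd hx h⟩
    · obtain ⟨p, hp⟩ := hG.connected.exists_walk_length_eq_dist x r
      cases p with
      | nil => exact absurd rfl hx
      | cons hadj q =>
        rename_i y
        refine ⟨y, fun h => absurd h hx, fun _ => ⟨hadj, ?_⟩⟩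
        have h1 := SimpleGraph.dist_le q
        have h2 := hG.connected.dist_triangle (u := x) (v := y) (w := r)
        rw [SimpleGraph.dist_eq_one_iff_adj.2 hadj] at h2
        rw [SimpleGraph.Walk.length_cons] at hp
        omega
  choose g hg1 hg2 using hstep
  have hroot : IsRootedAt g r := by
    refine ⟨hg1 r rfl, fun x => ?_⟩
    induction hd : G.dist x r generalizing x with
    | zero => exact ⟨0, (hG.connected.dist_eq_zero_iff).1 hd⟩
    | succ d ih =>
      have hx : x ≠ r := by rintro rfl; simp at hd
      obtain ⟨k, hk⟩ := ih (g x) (by have := (hg2 x hx).2; omega)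
      exact ⟨k + 1, hk⟩
  refine ⟨g, hroot, ?_⟩
  have hle : functionalGraph g ≤ G := by
    intro x y hxy
    obtain ⟨hne, rfl | rfl⟩ := functionalGraph_adj.1 hxy
    · exact (hg2 x fun hx => hne (by rw [hx, hg1 r rfl])).1
    · exact (hg2 y fun hy => hne (by rw [hy, hg1 r rfl])).1.symm
  exact ((SimpleGraph.isTree_iff_minimal_connected.1 hG).eq_of_ge hroot.connected hle).symm

end Rooted

theorem IsRootedAt.graphEdges_eq {n : ℕ} {g : Fin n → Fin n} {r : Fin n} (h : IsRootedAt g r) :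
    graphEdges (functionalGraph g) = (Finset.univ.erase r).val.map fun x => s(x, g x) := by
  have himg : (functionalGraph g).edgeSet.toFinite.toFinset =
      (Finset.univ.erase r).image fun x => s(x, g x) := by
    ext e
    simp [h.edgeSet_eq]
  have hcard := (SimpleGraph.isTree_iff_connected_and_card.1 h.isTree).2
  rw [Nat.card_coe_set_eq, Set.ncard_eq_toFinset_card _ (Set.toFinite _), himg] at hcard
  have hinj : Set.InjOn (fun x => s(x, g x)) (Finset.univ.erase r : Finset (Fin n)) := by
    rw [← Finset.card_image_iff, Finset.card_erase_of_mem (Finset.mem_univ r), Finset.card_univ,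
      ← Nat.card_eq_fintype_card]
    omega
  rw [graphEdges, himg, Finset.image_val_of_injOn hinj]

theorem msdCard_add_add_le {α : Type*} (A B C : Multiset α) :
    msdCard (A + B) (A + C) ≤ B.card + C.card := by
  rw [msdCard, add_tsub_add_eq_tsub_left, add_tsub_add_eq_tsub_left, Multiset.card_add]
  exact add_le_add (Multiset.card_le_card (Multiset.sub_le_self _ _))
    (Multiset.card_le_card (Multiset.sub_le_self _ _))

/-- If `f` and the parent function `g` agree off a set `D` containing the root, the edges of `f`
and of the tree differ in at most `2 * D.card` places. -/
theorem IsRootedAt.msdCard_le {n : ℕ} {f g : Fin n → Fin n} {r : Fin n} (h : IsRootedAt g r)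
    (D : Finset (Fin n)) (hr : r ∈ D) (hD : ∀ x ∉ D, g x = f x) :
    msdCard (funEdges f) (graphEdges (functionalGraph g)) ≤ 2 * D.card := by
  have hf : funEdges f = (Dᶜ.val.map fun x => s(x, f x)) + D.val.map fun x => s(x, f x) := by
    have hu : Dᶜ.disjUnion D disjoint_compl_left = Finset.univ := by
      ext x
      simp [em']
    rw [funEdges, ← Multiset.map_add, ← hu]
    rfl
  have hg : graphEdges (functionalGraph g) =
      (Dᶜ.val.map fun x => s(x, f x)) + (D.erase r).val.map fun x => s(x, g x) := by
    have hd : Disjoint Dᶜ (D.erase r) :=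
      disjoint_compl_left.mono_right (Finset.erase_subset _ _)
    have hu : Dᶜ.disjUnion (D.erase r) hd = Finset.univ.erase r := by
      ext x
      simp only [Finset.mem_disjUnion, Finset.mem_compl, Finset.mem_erase, Finset.mem_univ]
      grind
    have hc : (Dᶜ.val.map fun x => s(x, f x)) = Dᶜ.val.map fun x => s(x, g x) :=
      Multiset.map_congr rfl fun x hx => by rw [hD x (Finset.mem_compl.1 hx)]
    rw [h.graphEdges_eq, hc, ← Multiset.map_add, ← hu]
    rfl
  rw [hf, hg]
  refine (msdCard_add_add_le _ _ _).trans ?_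
  have := Finset.card_erase_le (s := D) (a := r)
  simp only [Multiset.card_map, Finset.card_val]
  omega

section Core

variable {V : Type*} {f g : V → V} {x y : V}

theorem inCore.apply (hx : inCore f x) : inCore f (f x) := by
  obtain ⟨j, hj, h⟩ := hx
  exact ⟨j, hj, Function.IsPeriodicPt.apply h⟩

theorem inCore.iterate (hx : inCore f x) (k : ℕ) : inCore f (f^[k] x) := by
  obtain ⟨j, hj, h⟩ := hx
  exact ⟨j, hj, Function.IsPeriodicPt.apply_iterate h k⟩

theorem inCore.eq_of_apply_eq (hx : inCore f x) (hy : inCore f y) (h : f x = f y) : x = y := by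
  obtain ⟨i, hi, hix⟩ := hx
  obtain ⟨j, hj, hjy⟩ := hy
  exact Function.IsPeriodicPt.eq_of_apply_eq hix hjy hi hj h

theorem exists_iterate_inCore [Finite V] (f : V → V) (x : V) : ∃ k, inCore f (f^[k] x) := by
  obtain ⟨i, j, hne, hij⟩ := Finite.exists_ne_map_eq_of_infinite fun k : ℕ => f^[k] x
  wlog hlt : i < j generalizing i j
  · exact this j i hne.symm hij.symm (by omega)
  refine ⟨i, j - i, by omega, ?_⟩
  rw [← Function.iterate_add_apply, Nat.sub_add_cancel hlt.le]
  exact hij.symm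

/-- If `g` agrees with `f` off `S`, whatever reaches `S` under `f` does so under `g`. -/
theorem exists_iterate_mem_of_eqOn_compl {S : Set V} (h : ∀ x ∉ S, g x = f x)
    (hx : ∃ k, f^[k] x ∈ S) : ∃ k, g^[k] x ∈ S := by
  obtain ⟨k, hk⟩ := hx
  induction k generalizing x with
  | zero => exact ⟨0, hk⟩
  | succ k ih =>
    by_cases hxS : x ∈ S
    · exact ⟨0, hxS⟩
    · obtain ⟨i, hi⟩ := ih (x := f x) hk
      exact ⟨i + 1, by rwa [Function.iterate_succ_apply, h x hxS]⟩

end Core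

section Merge

variable {V : Type*} [Fintype V]

/-- The forward orbit of `x`. -/
noncomputable def forwardOrbit (f : V → V) (x : V) : Finset V :=
  Finset.univ.filter fun y => ∃ j : ℕ, f^[j] x = y

theorem mem_forwardOrbit {f : V → V} {x y : V} : y ∈ forwardOrbit f x ↔ ∃ j : ℕ, f^[j] x = y := by
  simp [forwardOrbit]

theorem self_mem_forwardOrbit (f : V → V) (x : V) : x ∈ forwardOrbit f x :=
  mem_forwardOrbit.2 ⟨0, rfl⟩

theorem inCore.forwardOrbit_apply {f : V → V} {x : V} (hx : inCore f x) :
    forwardOrbit f (f x) = forwardOrbit f x := by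
  ext y
  simp only [mem_forwardOrbit]
  constructor
  · rintro ⟨j, rfl⟩
    exact ⟨j + 1, rfl⟩
  · rintro ⟨j, rfl⟩
    obtain ⟨p, hp, h⟩ := hx
    refine ⟨j + (p - 1), ?_⟩
    rw [← Function.iterate_succ_apply, show (j + (p - 1)).succ = j + p by omega,
      Function.iterate_add_apply, h]

variable [LinearOrder V] {f : V → V} {x y : V}

/-- The largest element of the forward orbit of `x`. -/
noncomputable def cycleMax (f : V → V) (x : V) : V :=
  (forwardOrbit f x).max' ⟨x, self_mem_forwardOrbit f x⟩

theorem le_cycleMax (f : V → V) (x : V) : x ≤ cycleMax f x :=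
  Finset.le_max' _ _ (self_mem_forwardOrbit f x)

theorem cycleMax_congr (h : forwardOrbit f x = forwardOrbit f y) : cycleMax f x = cycleMax f y := by
  simp only [cycleMax, h]

theorem inCore.cycleMax_apply (hx : inCore f x) : cycleMax f (f x) = cycleMax f x :=
  cycleMax_congr hx.forwardOrbit_apply

theorem inCore.cycleMax_iterate (hx : inCore f x) (k : ℕ) :
    cycleMax f (f^[k] x) = cycleMax f x := by
  induction k with
  | zero => rfl
  | succ k ih => rw [Function.iterate_succ_apply', (hx.iterate k).cycleMax_apply, ih]

theorem exists_iterate_eq_cycleMax (f : V → V) (x : V) : ∃ j, f^[j] x = cycleMax f x :=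
  mem_forwardOrbit.1 (Finset.max'_mem _ _)

theorem inCore.exists_iterate_succ_eq_cycleMax (hx : inCore f x) :
    ∃ j, f^[j + 1] x = cycleMax f x := by
  obtain ⟨j, hj⟩ := exists_iterate_eq_cycleMax f x
  obtain ⟨p, hp, h⟩ := hx
  refine ⟨j + (p - 1), ?_⟩
  rw [show j + (p - 1) + 1 = j + p by omega, Function.iterate_add_apply, h, hj]

theorem inCore.inCore_cycleMax (hx : inCore f x) : inCore f (cycleMax f x) := by
  obtain ⟨j, hj⟩ := exists_iterate_eq_cycleMax f x
  exact hj ▸ hx.iterate j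

theorem inCore.cycleMax_cycleMax (hx : inCore f x) : cycleMax f (cycleMax f x) = cycleMax f x := by
  obtain ⟨j, hj⟩ := exists_iterate_eq_cycleMax f x
  conv_lhs => rw [← hj]
  exact hx.cycleMax_iterate j

theorem inCore.exists_iterate_cycleMax_eq (hx : inCore f x) : ∃ j, f^[j] (cycleMax f x) = x := by
  obtain ⟨j, hj⟩ := exists_iterate_eq_cycleMax f x
  obtain ⟨p, hp, h⟩ := hx
  refine ⟨j * p - j, ?_⟩
  rw [← hj, ← Function.iterate_add_apply, Nat.sub_add_cancel (Nat.le_mul_of_pos_right j hp)]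
  exact Function.IsPeriodicPt.const_mul h j

/-- A core element whose image is the largest element of its cycle. -/
def IsCloser (f : V → V) (x : V) : Prop := inCore f x ∧ f x = cycleMax f x

theorem card_closers_le_cycleCount (f : V → V) :
    (Finset.univ.filter fun x => IsCloser f x).card ≤ cycleCount f := by
  rw [cycleCount, ← Set.ncard_coe_finset]
  refine Set.ncard_le_ncard_of_injOn (fun x => {y | ∃ j : ℕ, f^[j] x = y}) ?_ ?_ (Set.toFinite _)
  · intro x hx
    simp only [Finset.coe_filter, Finset.mem_univ, true_and] at hx
    exact ⟨x, hx.1, rfl⟩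
  · intro x hx y hy hxy
    simp only [Finset.coe_filter, Finset.mem_univ, true_and] at hx hy
    have ho : forwardOrbit f x = forwardOrbit f y := by
      ext z
      rw [mem_forwardOrbit, mem_forwardOrbit]
      exact Set.ext_iff.1 hxy z
    exact hx.1.eq_of_apply_eq hy.1 (hx.2.trans ((cycleMax_congr ho).trans hy.2.symm))

/-- The largest elements of the cycles of `f`. -/
noncomputable def cycleMaxima (f : V → V) : Finset V :=
  Finset.univ.filter fun x => inCore f x ∧ cycleMax f x = x

theorem mem_cycleMaxima : x ∈ cycleMaxima f ↔ inCore f x ∧ cycleMax f x = x := by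
  simp [cycleMaxima]

theorem inCore.cycleMax_mem_cycleMaxima (hx : inCore f x) : cycleMax f x ∈ cycleMaxima f :=
  mem_cycleMaxima.2 ⟨hx.inCore_cycleMax, hx.cycleMax_cycleMax⟩

theorem cycleMaxima_nonempty [Nonempty V] (f : V → V) : (cycleMaxima f).Nonempty := by
  obtain ⟨k, hk⟩ := exists_iterate_inCore f (Classical.arbitrary V)
  exact ⟨_, hk.cycleMax_mem_cycleMaxima⟩

/-- Rényi's transformation: concatenate the cycles of `f`, each starting with its largest element,
in increasing order of these elements. -/
noncomputable def mergeCycles (f : V → V) (x : V) : V :=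
  if IsCloser f x then
    if h : ((cycleMaxima f).filter (cycleMax f x < ·)).Nonempty then Finset.min' _ h else x
  else f x

theorem mergeCycles_of_not_isCloser (hx : ¬ IsCloser f x) : mergeCycles f x = f x := by
  simp [mergeCycles, hx]

theorem IsCloser.mergeCycles_cases (hx : IsCloser f x) :
    (mergeCycles f x = x ∧ ∀ m ∈ cycleMaxima f, m ≤ cycleMax f x) ∨
    (mergeCycles f x ∈ cycleMaxima f ∧ cycleMax f x < mergeCycles f x ∧
      ∀ m ∈ cycleMaxima f, cycleMax f x < m → mergeCycles f x ≤ m) := by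
  by_cases h : ((cycleMaxima f).filter (cycleMax f x < ·)).Nonempty
  · right
    have he : mergeCycles f x = Finset.min' _ h := by simp only [mergeCycles, hx, h, if_true, dif_pos]
    have hm := Finset.min'_mem _ h
    rw [Finset.mem_filter] at hm
    rw [he]
    exact ⟨hm.1, hm.2, fun m hm hlt => Finset.min'_le _ _ (Finset.mem_filter.2 ⟨hm, hlt⟩)⟩
  · left
    refine ⟨by simp only [mergeCycles, hx, h, if_true, dif_neg, not_false_eq_true], fun m hm => ?_⟩
    by_contra hlt
    exact h ⟨m, Finset.mem_filter.2 ⟨hm, not_le.1 hlt⟩⟩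

theorem inCore.inCore_mergeCycles (hx : inCore f x) : inCore f (mergeCycles f x) := by
  by_cases hc : IsCloser f x
  · rcases hc.mergeCycles_cases with h | h
    · rwa [h.1]
    · exact (mem_cycleMaxima.1 h.1).1
  · rw [mergeCycles_of_not_isCloser hc]
    exact hx.apply

theorem inCore.exists_iterate_isCloser (hx : inCore f x) :
    ∃ k, IsCloser f ((mergeCycles f)^[k] x) ∧
      cycleMax f ((mergeCycles f)^[k] x) = cycleMax f x := by
  obtain ⟨j, hj⟩ := hx.exists_iterate_succ_eq_cycleMax
  induction j generalizing x with
  | zero => exact ⟨0, ⟨hx, hj⟩, rfl⟩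
  | succ j ih =>
    by_cases hc : IsCloser f x
    · exact ⟨0, hc, rfl⟩
    · obtain ⟨k, hk1, hk2⟩ := ih hx.apply (hj.trans hx.cycleMax_apply.symm)
      refine ⟨k + 1, ?_⟩
      rw [Function.iterate_succ_apply, mergeCycles_of_not_isCloser hc, ← hx.cycleMax_apply]
      exact ⟨hk1, hk2⟩

theorem exists_isRootedAt_mergeCycles [Nonempty V] (f : V → V) :
    ∃ r, IsCloser f r ∧ IsRootedAt (mergeCycles f) r := by
  set t := (cycleMaxima f).max' (cycleMaxima_nonempty f) with ht
  have htm : t ∈ cycleMaxima f := Finset.max'_mem _ _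
  have hle : ∀ m ∈ cycleMaxima f, m ≤ t := fun m hm => Finset.le_max' _ _ hm
  obtain ⟨k, hk, hkt⟩ := (mem_cycleMaxima.1 htm).1.exists_iterate_isCloser
  rw [(mem_cycleMaxima.1 htm).2] at hkt
  set r := (mergeCycles f)^[k] t with hr
  refine ⟨r, hk, ?_, ?_⟩
  · rcases hk.mergeCycles_cases with h | h
    · exact h.1
    · exact absurd (hle _ h.1) (not_le.2 (hkt ▸ h.2.1))
  have hcore : ∀ x, inCore f x → ∃ k, (mergeCycles f)^[k] x = r := by
    intro x hx
    induction hm : cycleMax f x using WellFoundedGT.induction generalizing x with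
    | ind m ih =>
      obtain ⟨i, hi, him⟩ := hx.exists_iterate_isCloser
      rcases hi.mergeCycles_cases with h | h
      · refine ⟨i, hi.1.eq_of_apply_eq hk.1 ?_⟩
        rw [hi.2, hk.2, hkt]
        exact le_antisymm (hle _ hi.1.cycleMax_mem_cycleMaxima) (h.2 t htm)
      · obtain ⟨j, hj⟩ := ih _ (by rw [← hm, ← him]; exact h.2.1) _ (mem_cycleMaxima.1 h.1).1
          (mem_cycleMaxima.1 h.1).2
        refine ⟨j + 1 + i, ?_⟩
        rw [Function.iterate_add_apply, Function.iterate_succ_apply, hj]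
  intro x
  obtain ⟨i, hi⟩ : ∃ i, (mergeCycles f)^[i] x ∈ {x | inCore f x} :=
    exists_iterate_mem_of_eqOn_compl (fun x hx => mergeCycles_of_not_isCloser fun hc => hx hc.1)
      (exists_iterate_inCore f x)
  obtain ⟨j, hj⟩ := hcore _ hi
  exact ⟨j + i, by rw [Function.iterate_add_apply, hj]⟩

/-- The first element of the concatenation of the cycles. -/
noncomputable def mergeStart [Nonempty V] (f : V → V) : V :=
  (cycleMaxima f).min' (cycleMaxima_nonempty f)

theorem mergeStart_mem [Nonempty V] (f : V → V) : mergeStart f ∈ cycleMaxima f :=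
  Finset.min'_mem _ _

theorem inCore_iff_exists_iterate_mergeStart [Nonempty V] :
    inCore f x ↔ ∃ k, (mergeCycles f)^[k] (mergeStart f) = x := by
  constructor
  · intro hx
    induction hm : cycleMax f x using WellFoundedLT.induction generalizing x with
    | ind m ih =>
      have hmm : m ∈ cycleMaxima f := hm ▸ hx.cycleMax_mem_cycleMaxima
      have hstart : ∃ k, (mergeCycles f)^[k] (mergeStart f) = m := by
        by_cases hne : ((cycleMaxima f).filter (· < m)).Nonempty
        · set p := Finset.max' _ hne with hp
          have hpm := Finset.mem_filter.1 (Finset.max'_mem _ hne)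
          rw [← hp] at hpm
          obtain ⟨hpc, hpp⟩ := mem_cycleMaxima.1 hpm.1
          obtain ⟨i, hi, hip⟩ := hpc.exists_iterate_isCloser
          rw [hpp] at hip
          obtain ⟨k, hk⟩ := ih p hpm.2 hi.1 hip
          refine ⟨k + 1, ?_⟩
          rw [Function.iterate_succ_apply', hk]
          rcases hi.mergeCycles_cases with h | h
          · exact absurd (h.2 m hmm) (not_le.2 (by rw [hip]; exact hpm.2))
          · refine le_antisymm (h.2.2 m hmm (by rw [hip]; exact hpm.2)) (not_lt.1 fun hlt => ?_)
            have := Finset.le_max' ((cycleMaxima f).filter (· < m)) _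
              (Finset.mem_filter.2 ⟨h.1, hlt⟩)
            exact absurd h.2.1 (not_lt.2 (this.trans_eq hip.symm))
        · refine ⟨0, le_antisymm (Finset.min'_le _ _ hmm) (not_lt.1 fun hlt => hne ?_)⟩
          exact ⟨_, Finset.mem_filter.2 ⟨mergeStart_mem f, hlt⟩⟩
      obtain ⟨hmc, hmx⟩ := mem_cycleMaxima.1 hmm
      have hall : ∀ j, ∃ k, (mergeCycles f)^[k] (mergeStart f) = f^[j] m := by
        intro j
        induction j with
        | zero => exact hstart
        | succ j ihj =>
          rw [Function.iterate_succ_apply']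
          by_cases hc : IsCloser f (f^[j] m)
          · rw [hc.2, hmc.cycleMax_iterate, hmx]
            exact hstart
          · obtain ⟨k, hk⟩ := ihj
            exact ⟨k + 1, by rw [Function.iterate_succ_apply', hk, mergeCycles_of_not_isCloser hc]⟩
      obtain ⟨j, hj⟩ := hx.exists_iterate_cycleMax_eq
      rw [hm] at hj
      exact hj ▸ hall j
  · rintro ⟨k, rfl⟩
    induction k with
    | zero => exact (mem_cycleMaxima.1 (mergeStart_mem f)).1
    | succ k ih =>
      rw [Function.iterate_succ_apply']
      exact ih.inCore_mergeCycles

theorem inCore.cycleMax_mergeCycles (hx : inCore f x) :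
    cycleMax f (mergeCycles f x) = max (cycleMax f x) (mergeCycles f x) := by
  by_cases hc : IsCloser f x
  · rcases hc.mergeCycles_cases with h | h
    · rw [h.1, max_eq_left (le_cycleMax f x)]
    · rw [(mem_cycleMaxima.1 h.1).2, max_eq_right h.2.1.le]
  · rw [mergeCycles_of_not_isCloser hc, hx.cycleMax_apply, max_eq_left]
    exact (le_cycleMax f _).trans_eq hx.cycleMax_apply

theorem inCore.eq_ite_mergeCycles (hx : inCore f x) :
    f x = if cycleMax f x < mergeCycles f x ∨ mergeCycles f x = x then cycleMax f x
      else mergeCycles f x := by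
  by_cases hc : IsCloser f x
  · rcases hc.mergeCycles_cases with h | h
    · rw [if_pos (.inr h.1), hc.2]
    · rw [if_pos (.inl h.2.1), hc.2]
  · rw [mergeCycles_of_not_isCloser hc, if_neg]
    rintro (h | h)
    · exact absurd ((le_cycleMax f _).trans_eq hx.cycleMax_apply) (not_le.2 h)
    · obtain ⟨j, hj⟩ := exists_iterate_eq_cycleMax f x
      rw [Function.iterate_fixed h] at hj
      exact hc ⟨hx, h.trans hj⟩

theorem mergeCycles_injective [Nonempty V] {f' : V → V} (hg : mergeCycles f = mergeCycles f')
    (hu : mergeStart f = mergeStart f') : f = f' := by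
  have hcore : ∀ x, inCore f x ↔ inCore f' x := fun x => by
    rw [inCore_iff_exists_iterate_mergeStart, inCore_iff_exists_iterate_mergeStart, hg, hu]
  have hmax : ∀ k, cycleMax f ((mergeCycles f)^[k] (mergeStart f)) =
      cycleMax f' ((mergeCycles f)^[k] (mergeStart f)) := by
    intro k
    induction k with
    | zero =>
      rw [Function.iterate_zero_apply, (mem_cycleMaxima.1 (mergeStart_mem f)).2, hu,
        (mem_cycleMaxima.1 (mergeStart_mem f')).2]
    | succ k ih =>
      have hk := inCore_iff_exists_iterate_mergeStart (f := f).2 ⟨k, rfl⟩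
      have hk' := (hcore _).1 hk
      rw [Function.iterate_succ_apply', hk.cycleMax_mergeCycles, ih]
      rw [hg] at hk' ⊢
      exact hk'.cycleMax_mergeCycles.symm
  funext x
  by_cases hx : inCore f x
  · obtain ⟨k, hk⟩ := inCore_iff_exists_iterate_mergeStart.1 hx
    have hm := hmax k
    rw [hk] at hm
    rw [hx.eq_ite_mergeCycles, ((hcore x).1 hx).eq_ite_mergeCycles, hm, hg]
  · have h1 := mergeCycles_of_not_isCloser (f := f) (x := x) fun hc => hx hc.1
    have h2 := mergeCycles_of_not_isCloser (f := f') (x := x) fun hc => hx ((hcore x).2 hc.1)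
    rw [← h1, ← h2, hg]

end Merge

section Joyal

variable {V : Type*} [Fintype V] {g g' : V → V} {r r' u u' : V}

theorem IsRootedAt.forwardOrbit_eq (h : IsRootedAt g r) (u : V) :
    ∃ k, g^[k] u = r ∧ (forwardOrbit g u).card = k + 1 ∧
      Set.InjOn (fun i => g^[i] u) (Finset.range (k + 1)) ∧
      forwardOrbit g u = (Finset.range (k + 1)).image fun i => g^[i] u := by
  set k := Nat.find (h.2 u) with hk
  have hkr : g^[k] u = r := Nat.find_spec (h.2 u)
  have hmin : ∀ i < k, g^[i] u ≠ r := fun i hi => Nat.find_min (h.2 u) hi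
  have hinj : Set.InjOn (fun i => g^[i] u) (Finset.range (k + 1)) := by
    intro i hi j hj hij
    simp only [Finset.coe_range, Set.mem_Iio] at hi hj
    have key : ∀ a b, a < b → b < k + 1 → g^[a] u ≠ g^[b] u := by
      intro a b hab hb he
      refine hmin (k - b + a) (by omega) ?_
      rw [Function.iterate_add_apply, he, ← Function.iterate_add_apply,
        Nat.sub_add_cancel (by omega), hkr]
    rcases lt_trichotomy i j with hlt | heq | hlt
    · exact absurd hij (key i j hlt hj)
    · exact heq
    · exact absurd hij.symm (key j i hlt hi)
  have himg : forwardOrbit g u = (Finset.range (k + 1)).image fun i => g^[i] u := by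
    ext y
    simp only [mem_forwardOrbit, Finset.mem_image, Finset.mem_range]
    constructor
    · rintro ⟨j, rfl⟩
      by_cases hj : j < k + 1
      · exact ⟨j, hj, rfl⟩
      · refine ⟨k, by omega, ?_⟩
        rw [hkr, show j = j - k + k by omega, Function.iterate_add_apply, hkr,
          Function.iterate_fixed h.1]
    · rintro ⟨j, _, rfl⟩
      exact ⟨j, rfl⟩
  exact ⟨k, hkr, by rw [himg, Finset.card_image_of_injOn hinj, Finset.card_range], hinj, himg⟩

/-- Joyal's map: read the path from `u` to the root as a permutation of its vertex set. -/
noncomputable def joyalMap (g : V → V) (u x : V) : V :=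
  if h : x ∈ forwardOrbit g u then g^[(forwardOrbit g u).equivFin ⟨x, h⟩] u else g x

theorem joyalMap_of_notMem {x : V} (h : x ∉ forwardOrbit g u) : joyalMap g u x = g x := by
  simp [joyalMap, h]

theorem joyalMap_equivFin_symm {S : Finset V} (hS : forwardOrbit g u = S) (i : Fin S.card) :
    joyalMap g u (S.equivFin.symm i) = g^[i] u := by
  subst hS
  simp [joyalMap]

theorem joyalMap_mem {x : V} (h : x ∈ forwardOrbit g u) : joyalMap g u x ∈ forwardOrbit g u := by
  rw [joyalMap, dif_pos h]
  exact mem_forwardOrbit.2 ⟨_, rfl⟩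

theorem IsRootedAt.joyalMap_injOn (h : IsRootedAt g r) (u : V) :
    Set.InjOn (joyalMap g u) (forwardOrbit g u) := by
  obtain ⟨k, -, hcard, hinj, -⟩ := h.forwardOrbit_eq u
  intro x hx y hy hxy
  rw [Finset.mem_coe] at hx hy
  rw [joyalMap, joyalMap, dif_pos hx, dif_pos hy] at hxy
  have := hinj (by simpa [hcard] using ((forwardOrbit g u).equivFin ⟨x, hx⟩).2.trans_eq hcard)
    (by simpa [hcard] using ((forwardOrbit g u).equivFin ⟨y, hy⟩).2.trans_eq hcard) hxy
  simpa using (forwardOrbit g u).equivFin.injective (Fin.ext this)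

theorem IsRootedAt.inCore_joyalMap_iff (h : IsRootedAt g r) {x : V} :
    inCore (joyalMap g u) x ↔ x ∈ forwardOrbit g u := by
  have hmaps : Set.MapsTo (joyalMap g u) (forwardOrbit g u) (forwardOrbit g u) :=
    fun x hx => joyalMap_mem hx
  constructor
  · rintro ⟨p, hp, hpx⟩
    have hr : r ∈ forwardOrbit g u := mem_forwardOrbit.2 (h.2 u)
    obtain ⟨k, hk⟩ : ∃ k, (joyalMap g u)^[k] x ∈ (forwardOrbit g u : Set V) :=
      exists_iterate_mem_of_eqOn_compl (fun x hx => joyalMap_of_notMem hx)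
        ((h.2 x).imp fun k hk => by rw [hk]; exact hr)
    have := hmaps.iterate (k * p - k) hk
    rw [← Function.iterate_add_apply, Nat.sub_add_cancel (Nat.le_mul_of_pos_right k hp)] at this
    rwa [Function.IsPeriodicPt.const_mul hpx k] at this
  · intro hx
    obtain ⟨i, j, hne, hij⟩ :=
      Finite.exists_ne_map_eq_of_infinite fun k : ℕ => (joyalMap g u)^[k] x
    wlog hlt : i < j generalizing i j
    · exact this j i hne.symm hij.symm (by omega)
    refine ⟨j - i, by omega, ?_⟩
    refine ((h.joyalMap_injOn u).iterate hmaps i) (hmaps.iterate _ hx) hx ?_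
    rw [← Function.iterate_add_apply, show i + (j - i) = j by omega]
    exact hij.symm

theorem joyalMap_injective (h : IsRootedAt g r) (h' : IsRootedAt g' r')
    (he : joyalMap g u = joyalMap g' u') : g = g' ∧ u = u' := by
  have hS : forwardOrbit g' u' = forwardOrbit g u := by
    ext x
    rw [← h.inCore_joyalMap_iff, ← h'.inCore_joyalMap_iff, he]
  obtain ⟨k, hk, hcard, -, himg⟩ := h.forwardOrbit_eq u
  obtain ⟨k', hk', hcard', -, -⟩ := h'.forwardOrbit_eq u'
  obtain rfl : k = k' := by rw [hS] at hcard'; omega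
  have hiter : ∀ i < k + 1, g^[i] u = g'^[i] u' := by
    intro i hi
    rw [← hcard] at hi
    have h1 := joyalMap_equivFin_symm (g := g) (u := u) rfl ⟨i, hi⟩
    rw [he, joyalMap_equivFin_symm hS] at h1
    exact h1.symm
  refine ⟨?_, hiter 0 (by omega)⟩
  funext x
  by_cases hx : x ∈ forwardOrbit g u
  · rw [himg, Finset.mem_image] at hx
    obtain ⟨i, hi, rfl⟩ := hx
    rw [Finset.mem_range] at hi
    by_cases hik : i < k
    · have := hiter (i + 1) (by omega)
      rw [Function.iterate_succ_apply', Function.iterate_succ_apply', ← hiter i hi] at this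
      exact this
    · obtain rfl : i = k := by omega
      have hr := hiter i hi
      rw [hk, hk'] at hr
      rw [hk, h.1, hr, h'.1]
  · rw [← joyalMap_of_notMem hx, he, joyalMap_of_notMem (hS ▸ hx)]

end Joyal

theorem renyi_joyal_roots_removed (n : ℕ) (hn : 1 ≤ n) :
    ∃ R : (Fin n → Fin n) → {G : SimpleGraph (Fin n) // G.IsTree},
      (∀ T : {G : SimpleGraph (Fin n) // G.IsTree},
        Set.ncard {f : Fin n → Fin n | R f = T} = n ^ 2) ∧
      (∀ f : Fin n → Fin n,
        msdCard (funEdges f) (graphEdges (R f).1) ≤ 2 * cycleCount f) := by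
  have : Nonempty (Fin n) := ⟨⟨0, hn⟩⟩
  choose root hcloser hrooted using fun f : Fin n → Fin n => exists_isRootedAt_mergeCycles f
  let F : (Fin n → Fin n) → {G : SimpleGraph (Fin n) // G.IsTree} × (Fin n × Fin n) :=
    fun f => (⟨_, (hrooted f).isTree⟩, root f, mergeStart f)
  have hF : Function.Injective F := by
    intro f f' h
    obtain ⟨hT, hr, hu⟩ : functionalGraph (mergeCycles f) = functionalGraph (mergeCycles f') ∧
        root f = root f' ∧ mergeStart f = mergeStart f' := by
      simpa [F] using h
    exact mergeCycles_injective
      ((hrooted f).eq_of_functionalGraph_eq (hr ▸ hrooted f') hT) hu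
  choose parent hparent hgraph using
    fun (T : {G : SimpleGraph (Fin n) // G.IsTree}) r => T.2.exists_isRootedAt r
  let B : {G : SimpleGraph (Fin n) // G.IsTree} × (Fin n × Fin n) → (Fin n → Fin n) :=
    fun t => joyalMap (parent t.1 t.2.1) t.2.2
  have hB : Function.Injective B := by
    rintro ⟨T, r, u⟩ ⟨T', r', u'⟩ h
    obtain ⟨hg, hu⟩ := joyalMap_injective (hparent T r) (hparent T' r') h
    have hT : T = T' := Subtype.ext (by rw [← hgraph T r, ← hgraph T' r', hg])
    have hr : r = r' := (hparent T' r').eq_root_of_fixed (hg ▸ (hparent T r).1)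
    rw [hT, hr, show u = u' from hu]
  have hcard := le_antisymm (Nat.card_le_card_of_injective F hF) (Nat.card_le_card_of_injective B hB)
  have hFbij : Function.Bijective F :=
    (Nat.bijective_iff_injective_and_card F).2 ⟨hF, hcard⟩
  refine ⟨fun f => (F f).1, fun T => ?_, fun f => ?_⟩
  · have hset : {f | (F f).1 = T} = F ⁻¹' ({T} ×ˢ Set.univ) := by
      ext f
      simp
    rw [hset, Set.ncard_preimage_of_injective_subset_range hF (by simp [hFbij.2.range_eq]),
      Set.ncard_prod]
    simp [sq]
  · refine ((hrooted f).msdCard_le (Finset.univ.filter fun x => IsCloser f x)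
      (by simpa using hcloser f) fun x hx => mergeCycles_of_not_isCloser (by simpa using hx)).trans ?_
    exact Nat.mul_le_mul_left 2 (card_closers_le_cycleCount f)
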